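/- Let 𝒜 be an abelian category with enough projective objects and suppose the object M of 𝒜 admits a finite quasi-projective resolution P•. If Ext_𝒜^n(M, M) = 0 for all integers n with 2 ≤ n ≤ hsup(P•) − hinf(P•) + 1, then pd_𝒜(M) < ∞. -/

import Mathlib

/-!
Quasi-projective dimension, following Gheibi–Jorgensen–Takahashi and
Chen–Chen–Liu, "Properties of quasi-projective dimension over abelian categories".
-/

open CategoryTheory CategoryTheory.Limits

attribute [local instance] CategoryTheory.Abelian.hasFiniteBiproducts

noncomputable section

universe v u

namespace QPD

variable {A : Type*} [Category A] [Abelian A]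

/-- The direct sum of `n` copies of `M`. -/
def copies (M : A) (n : ℕ) : A := ⨁ (fun _ : Fin n => M)

/-- `X` belongs to `add M`: it is a direct summand of a finite direct sum of copies of `M`. -/
def inAdd (M X : A) : Prop :=
  ∃ (n : ℕ) (s : X ⟶ copies M n) (r : copies M n ⟶ X), s ≫ r = 𝟙 X

/-- `P` is a quasi-projective resolution of `M`: a bounded-below complex of projective
objects whose `j`-th homology is a direct sum of `mult j` copies of `M`, where the
multiplicities `mult j` are not all zero. -/
structure IsQuasiProjRes (M : A) (P : ChainComplex A ℤ) : Prop where
  projective : ∀ i, Projective (P.X i)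
  bddBelow : ∃ a : ℤ, ∀ i, i < a → IsZero (P.X i)
  homology_iso : ∃ mult : ℤ → ℕ, (∃ j, mult j ≠ 0) ∧
    ∀ j, Nonempty (P.homology j ≅ copies M (mult j))

/-- `P` is a finite (i.e. bounded) quasi-projective resolution of `M`. -/
structure IsFiniteQuasiProjRes (M : A) (P : ChainComplex A ℤ) extends
    IsQuasiProjRes M P : Prop where
  bddAbove : ∃ b : ℤ, ∀ i, b < i → IsZero (P.X i)

/-- `s` is the supremum of the degrees in which `P` is nonzero. -/
def IsSup (P : ChainComplex A ℤ) (s : ℤ) : Prop :=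
  ¬ IsZero (P.X s) ∧ ∀ i, s < i → IsZero (P.X i)

/-- `t` is the supremum of the degrees in which the homology of `P` is nonzero. -/
def IsHSup (P : ChainComplex A ℤ) (t : ℤ) : Prop :=
  ¬ IsZero (P.homology t) ∧ ∀ i, t < i → IsZero (P.homology i)

/-- `t` is the infimum of the degrees in which the homology of `P` is nonzero. -/
def IsHInf (P : ChainComplex A ℤ) (t : ℤ) : Prop :=
  ¬ IsZero (P.homology t) ∧ ∀ i, i < t → IsZero (P.homology i)

open Classical in
/-- The quasi-projective dimension of `M`, as an element of `ℕ∞`: the infimum of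
`sup P• - hsup P•` over all finite quasi-projective resolutions `P•` of `M`
(it is `0` for the zero object and `⊤` if no finite quasi-projective resolution exists). -/
def qpd (M : A) : ℕ∞ :=
  if IsZero M then 0
  else sInf {d : ℕ∞ | ∃ (P : ChainComplex A ℤ) (s t : ℤ),
    IsFiniteQuasiProjRes M P ∧ IsSup P s ∧ IsHSup P t ∧ d = ((s - t).toNat : ℕ∞)}

/-- `M` admits a projective resolution of length at most `n`. -/
def pdLE (M : A) (n : ℕ) : Prop :=
  ∃ P : ChainComplex A ℤ, (∀ i, Projective (P.X i)) ∧
    (∀ i : ℤ, i < 0 → IsZero (P.X i)) ∧ (∀ i : ℤ, (n : ℤ) < i → IsZero (P.X i)) ∧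
    (∀ i : ℤ, i ≠ 0 → IsZero (P.homology i)) ∧ Nonempty (P.homology 0 ≅ M)

/-- The projective dimension of `M`, as an element of `ℕ∞`. -/
def pd (M : A) : ℕ∞ := sInf {d : ℕ∞ | ∃ n : ℕ, d = (n : ℕ∞) ∧ pdLE M n}

open Classical in
/-- Quasi-projective dimension computed using only complexes all of whose terms satisfy the
predicate `Q` (e.g. `Q` = "finitely generated", for the category of finitely presented
modules over a left coherent ring). -/
def qpdRel (Q : A → Prop) (M : A) : ℕ∞ :=
  if IsZero M then 0
  else sInf {d : ℕ∞ | ∃ (P : ChainComplex A ℤ) (s t : ℤ),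
    IsFiniteQuasiProjRes M P ∧ (∀ i, Q (P.X i)) ∧ IsSup P s ∧ IsHSup P t ∧
    d = ((s - t).toNat : ℕ∞)}

/-- Projective dimension computed using only resolutions all of whose terms satisfy the
predicate `Q`. -/
def pdRel (Q : A → Prop) (M : A) : ℕ∞ :=
  sInf {d : ℕ∞ | ∃ n : ℕ, d = (n : ℕ∞) ∧ ∃ P : ChainComplex A ℤ,
    (∀ i, Projective (P.X i)) ∧ (∀ i, Q (P.X i)) ∧
    (∀ i : ℤ, i < 0 → IsZero (P.X i)) ∧ (∀ i : ℤ, (n : ℤ) < i → IsZero (P.X i)) ∧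
    (∀ i : ℤ, i ≠ 0 → IsZero (P.homology i)) ∧ Nonempty (P.homology 0 ≅ M)}

/-- Vanishing of the `n`-th Ext group, `Ext_𝒜^n(M, N) = 0`. -/
def extIsZero [EnoughProjectives A] (M N : A) (n : ℕ) : Prop :=
  IsZero (((_root_.Ext ℤ A n).obj (Opposite.op M)).obj N)

/-- The quasi-projective dimension of a finitely presented module over a (left coherent)
ring, computed inside the abelian category of finitely presented modules, i.e. via bounded
complexes of finitely generated projective modules. -/
def qpdFG {R : Type u} [Ring R] (M : ModuleCat.{u} R) : ℕ∞ :=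
  qpdRel (fun N : ModuleCat.{u} R => Module.Finite R N) M

/-- The projective dimension of a finitely presented module over a (left coherent) ring,
computed inside the abelian category of finitely presented modules. -/
def pdFG {R : Type u} [Ring R] (M : ModuleCat.{u} R) : ℕ∞ :=
  pdRel (fun N : ModuleCat.{u} R => Module.Finite R N) M

/-- A ring is left coherent if every finitely generated left ideal is finitely presented. -/
def IsLeftCoherent (R : Type u) [Ring R] : Prop :=
  ∀ I : Ideal R, I.FG → Module.FinitePresentation R I

/-- The quasi-global dimension of a ring: the supremum of the quasi-projective dimensions
of all finitely generated left modules. -/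
def qgldim (R : Type u) [Ring R] : ℕ∞ :=
  sSup {d : ℕ∞ | ∃ M : ModuleCat.{u} R, Module.Finite R M ∧ d = qpd M}

/-- The global dimension of a ring: the supremum of the projective dimensions of all
finitely generated left modules. -/
def gldim (R : Type u) [Ring R] : ℕ∞ :=
  sSup {d : ℕ∞ | ∃ M : ModuleCat.{u} R, Module.Finite R M ∧ d = pd M}

/-- The finitistic dimension of a ring: the supremum of the projective dimensions of all
finitely generated left modules of finite projective dimension. -/
def findim (R : Type u) [Ring R] : ℕ∞ :=
  sSup {d : ℕ∞ | ∃ M : ModuleCat.{u} R, Module.Finite R M ∧ d = pd M ∧ pd M ≠ ⊤}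

/-- The depth of a module over a Noetherian local ring:
`depth M = inf {i : Ext^i(R/𝔪, M) ≠ 0}`. -/
def depth {R : Type u} [CommRing R] [IsLocalRing R] (M : ModuleCat.{u} R) : ℕ∞ :=
  sInf {d : ℕ∞ | ∃ n : ℕ, d = (n : ℕ∞) ∧
    ¬ IsZero (((_root_.Ext ℤ (ModuleCat.{u} R) n).obj
      (Opposite.op (ModuleCat.of R (IsLocalRing.ResidueField R)))).obj M)}

end QPD

end

namespace QPD

variable {A : Type*} [Category A] [Abelian A]

section Boundaries

variable (K : ChainComplex A ℤ)

/-- The image of the differential `K.X (i + 1) ⟶ K.X i`. -/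
noncomputable def boundaries (i : ℤ) : A := Abelian.image (K.fromOpcycles (i + 1) i)

/-- The inclusion of the boundaries. -/
noncomputable def boundariesι (i : ℤ) : boundaries K i ⟶ K.X i := Abelian.image.ι _

/-- The corestriction of the differential to the boundaries. -/
noncomputable def toBoundaries (i : ℤ) : K.opcycles (i + 1) ⟶ boundaries K i :=
  Abelian.factorThruImage _

instance (i : ℤ) : Mono (boundariesι K i) :=
  inferInstanceAs (Mono (Abelian.image.ι (K.fromOpcycles (i + 1) i)))

instance (i : ℤ) : Epi (toBoundaries K i) :=
  inferInstanceAs (Epi (Abelian.factorThruImage (K.fromOpcycles (i + 1) i)))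

@[simp]
lemma toBoundaries_ι (i : ℤ) : toBoundaries K i ≫ boundariesι K i = K.fromOpcycles (i + 1) i :=
  Abelian.image.fac _

/-- The short complex `boundaries K i ⟶ K.X i ⟶ K.opcycles i`. -/
noncomputable abbrev boundariesShortComplex (i : ℤ) : ShortComplex A :=
  ShortComplex.mk (boundariesι K i) (K.pOpcycles i) (by
    rw [← cancel_epi (toBoundaries K i), ← Category.assoc, toBoundaries_ι,
      ← cancel_epi (K.pOpcycles (i + 1))]
    simp)

/-- The short complex `K.homology (i + 1) ⟶ K.opcycles (i + 1) ⟶ boundaries K i`. -/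
noncomputable abbrev homologyShortComplex (i : ℤ) : ShortComplex A :=
  ShortComplex.mk (K.homologyι (i + 1)) (toBoundaries K i) (by
    simp [← cancel_mono (boundariesι K i)])

lemma boundariesShortComplex_shortExact (i : ℤ) : (boundariesShortComplex K i).ShortExact := by
  refine ⟨?_⟩
  let φ : ShortComplex.mk (K.d (i + 1) i) (K.pOpcycles i) (K.d_pOpcycles _ _) ⟶
      boundariesShortComplex K i :=
    { τ₁ := K.pOpcycles (i + 1) ≫ toBoundaries K i
      τ₂ := 𝟙 _
      τ₃ := 𝟙 _
      comm₁₂ := by simp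
      comm₂₃ := by simp }
  have : Epi φ.τ₁ := epi_comp _ _
  have : IsIso φ.τ₂ := inferInstanceAs (IsIso (𝟙 _))
  have : Mono φ.τ₃ := inferInstanceAs (Mono (𝟙 _))
  rw [← ShortComplex.exact_iff_of_epi_of_isIso_of_mono φ]
  exact ShortComplex.exact_of_g_is_cokernel _ (K.opcyclesIsCokernel (i + 1) i (by simp))

lemma homologyShortComplex_shortExact (i : ℤ) : (homologyShortComplex K i).ShortExact := by
  refine ⟨?_⟩
  let φ : homologyShortComplex K i ⟶ ShortComplex.mk (K.homologyι (i + 1))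
      (K.fromOpcycles (i + 1) i) (K.homologyι_comp_fromOpcycles _ _) :=
    { τ₁ := 𝟙 _
      τ₂ := 𝟙 _
      τ₃ := boundariesι K i
      comm₁₂ := by simp
      comm₂₃ := by simp }
  have : Epi φ.τ₁ := inferInstanceAs (Epi (𝟙 _))
  have : IsIso φ.τ₂ := inferInstanceAs (IsIso (𝟙 _))
  have : Mono φ.τ₃ := inferInstanceAs (Mono (boundariesι K i))
  rw [ShortComplex.exact_iff_of_epi_of_isIso_of_mono φ]
  exact ShortComplex.exact_of_f_is_kernel _ (K.homologyIsKernel (i + 1) i (by simp))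

variable {K}

lemma isZero_boundaries {i : ℤ} (h : IsZero (K.X i)) : IsZero (boundaries K i) :=
  h.of_mono (boundariesι K i)

lemma isZero_opcycles {i : ℤ} (h : IsZero (K.X i)) : IsZero (K.opcycles i) :=
  h.of_epi (K.pOpcycles i)

lemma exists_hasProjectiveDimensionLT_opcycles_of_boundaries {i : ℤ} [Projective (K.X i)]
    (h : ∃ n, HasProjectiveDimensionLT (boundaries K i) n) :
    ∃ n, HasProjectiveDimensionLT (K.opcycles i) n := by
  obtain ⟨n, hn⟩ := h
  refine ⟨n + 1, (boundariesShortComplex_shortExact K i).hasProjectiveDimensionLT_X₃ n hn ?_⟩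
  exact hasProjectiveDimensionLT_of_ge (K.X i) 1 (n + 1) (by lia)

lemma hasProjectiveDimensionLT_boundaries_iff {i : ℤ} (h : IsZero (K.homology (i + 1))) (n : ℕ) :
    HasProjectiveDimensionLT (boundaries K i) n ↔
      HasProjectiveDimensionLT (K.opcycles (i + 1)) n := by
  have : IsIso (toBoundaries K i) :=
    (homologyShortComplex_shortExact K i).isIso_g_iff.2 h
  let e : K.opcycles (i + 1) ≅ boundaries K i := asIso (toBoundaries K i)
  exact ⟨fun _ ↦ hasProjectiveDimensionLT_of_iso e.symm n,
    fun _ ↦ hasProjectiveDimensionLT_of_iso e n⟩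

lemma exists_hasProjectiveDimensionLT_opcycles (hK : ∀ i, Projective (K.X i)) {b t : ℤ}
    (hb : ∀ i, b < i → IsZero (K.X i)) (ht : ∀ i, t < i → IsZero (K.homology i)) :
    ∃ n, HasProjectiveDimensionLT (K.opcycles t) n := by
  have key : ∀ (m : ℕ) (i : ℤ), t ≤ i → b < i + m →
      ∃ n, HasProjectiveDimensionLT (K.opcycles i) n := by
    intro m
    induction m with
    | zero =>
      intro i _ hi
      exact ⟨0, (isZero_opcycles (hb i (by lia))).hasProjectiveDimensionLT_zero⟩
    | succ m ih =>
      intro i hti hi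
      obtain ⟨n, hn⟩ := ih (i + 1) (by lia) (by push_cast at hi; lia)
      exact exists_hasProjectiveDimensionLT_opcycles_of_boundaries
        ⟨n, (hasProjectiveDimensionLT_boundaries_iff (ht _ (by lia)) n).2 hn⟩
  exact key (b + 1 - t).toNat t le_rfl (by lia)

lemma projective_opcycles_of_hasProjectiveDimensionLT (hK : ∀ i, Projective (K.X i))
    (hH : ∀ i, 0 < i → IsZero (K.homology i)) (n : ℕ)
    [h : HasProjectiveDimensionLT (K.opcycles 0) (n + 1)] : Projective (K.opcycles n) := by
  have key : ∀ k m : ℕ, k + m = n → HasProjectiveDimensionLT (K.opcycles k) (m + 1) := by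
    intro k
    induction k with
    | zero =>
      rintro m rfl
      simpa using h
    | succ k ih =>
      intro m hm
      have := ih (m + 1) (by lia)
      have hB : HasProjectiveDimensionLT (boundaries K (k : ℤ)) (m + 1) :=
        (boundariesShortComplex_shortExact K k).hasProjectiveDimensionLT_X₁ (m + 1)
          (hasProjectiveDimensionLT_of_ge (K.X k) 1 (m + 1) (by lia)) this
      exact_mod_cast (hasProjectiveDimensionLT_boundaries_iff (hH _ (by lia)) _).1 hB
  have := key n 0 (by lia)
  rwa [zero_add, ← projective_iff_hasProjectiveDimensionLT_one] at this

end Boundaries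

section Resolution

/-- The embedding of `down ℕ` into `down ℤ` given by the inclusion of `ℕ` into `ℤ`. -/
def embeddingDown : (ComplexShape.down ℕ).Embedding (ComplexShape.down ℤ) :=
  ComplexShape.Embedding.mk' _ _ (fun n ↦ (n : ℤ)) (fun _ _ h ↦ by simpa using h)
    (by simp; lia)

/-- The embedding of `up ℕ` into `down ℤ` sending `m` to `n - m`. -/
def embeddingDownLE (n : ℤ) : (ComplexShape.up ℕ).Embedding (ComplexShape.down ℤ) :=
  ComplexShape.Embedding.mk' _ _ (fun m ↦ n - m) (fun _ _ h ↦ by simpa using h)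
    (by simp; lia)

instance (n : ℤ) : (embeddingDownLE n).IsRelIff where
  rel' _ _ h := by simp [embeddingDownLE, ComplexShape.Embedding.mk'] at h ⊢; lia

instance (n : ℤ) : (embeddingDownLE n).IsTruncGE where
  mem_next {j k} h := ⟨j + 1, by
    simp [embeddingDownLE, ComplexShape.Embedding.mk'] at h ⊢; lia⟩

lemma embeddingDownLE_f_toNat {n i : ℤ} (h : i ≤ n) :
    (embeddingDownLE n).f (n - i).toNat = i := by
  simp [embeddingDownLE, ComplexShape.Embedding.mk']; lia

lemma embeddingDownLE_f_ne {n i : ℤ} (h : n < i) (j : ℕ) : (embeddingDownLE n).f j ≠ i := by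
  simp [embeddingDownLE, ComplexShape.Embedding.mk']; lia

lemma pdLE_of_complex {M : A} {K : ChainComplex A ℤ} (hK : ∀ i, Projective (K.X i))
    (hneg : ∀ i, i < 0 → IsZero (K.X i)) (hH : ∀ i, i ≠ 0 → IsZero (K.homology i))
    (e : K.homology 0 ≅ M) (n : ℕ) [Projective (K.opcycles n)] : pdLE M n := by
  have hX : ∀ i : ℤ, i < n → Nonempty ((K.truncGE (embeddingDownLE n)).X i ≅ K.X i) := by
    intro i hi
    refine ⟨K.truncGEXIso _ (embeddingDownLE_f_toNat hi.le) fun h ↦ ?_⟩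
    refine h.notMem (i' := i + 1) ?_ _ (embeddingDownLE_f_toNat (by lia))
    rw [embeddingDownLE_f_toNat hi.le]
    simp
  have hXn : Nonempty ((K.truncGE (embeddingDownLE n)).X n ≅ K.opcycles n) := by
    refine ⟨K.truncGEXIsoOpcycles _ (embeddingDownLE_f_toNat le_rfl)
      (ComplexShape.Embedding.boundaryGE _ (i' := (n : ℤ) + 1) ?_
        (embeddingDownLE_f_ne (by lia)))⟩
    rw [embeddingDownLE_f_toNat le_rfl]
    simp
  have hXz : ∀ i : ℤ, (n : ℤ) < i → IsZero ((K.truncGE (embeddingDownLE n)).X i) :=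
    fun i hi ↦ HomologicalComplex.isZero_extend_X _ _ _ (embeddingDownLE_f_ne hi)
  have hHiso : ∀ i : ℤ, i ≤ n →
      Nonempty (K.homology i ≅ (K.truncGE (embeddingDownLE n)).homology i) := by
    intro i hi
    have := K.quasiIsoAt_πTruncGE _ (embeddingDownLE_f_toNat hi)
    exact ⟨isoOfQuasiIsoAt (K.πTruncGE (embeddingDownLE n)) i⟩
  refine ⟨K.truncGE (embeddingDownLE n), fun i ↦ ?_, fun i hi ↦ ?_, hXz, fun i hi ↦ ?_, ?_⟩
  · rcases lt_trichotomy i n with hi | rfl | hi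
    · exact Projective.of_iso (hX i hi).some.symm (hK i)
    · exact Projective.of_iso hXn.some.symm inferInstance
    · exact (hXz i hi).projective
  · exact (hneg i hi).of_iso (hX i (by lia)).some
  · by_cases hin : i ≤ n
    · exact (hH i hi).of_iso (hHiso i hin).some.symm
    · exact ShortComplex.isZero_homology_of_isZero_X₂ _ (hXz i (by lia))
  · exact ⟨(hHiso 0 (by lia)).some.symm ≪≫ e⟩

lemma pdLE_of_hasProjectiveDimensionLT [EnoughProjectives A] (M : A) (n : ℕ)
    [HasProjectiveDimensionLT M (n + 1)] : pdLE M n := by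
  let R := ProjectiveResolution.of M
  let K : ChainComplex A ℤ := R.complex.extend embeddingDown
  have hf (k : ℕ) : embeddingDown.f k = k := rfl
  have hneg : ∀ i, i < 0 → IsZero (K.X i) := fun i hi ↦
    HomologicalComplex.isZero_extend_X _ _ _ fun j hj ↦ by rw [hf] at hj; lia
  have hK : ∀ i, Projective (K.X i) := by
    intro i
    by_cases hi : i < 0
    · exact (hneg i hi).projective
    · obtain ⟨k, rfl⟩ := Int.eq_ofNat_of_zero_le (not_lt.1 hi)
      exact Projective.of_iso (R.complex.extendXIso embeddingDown (hf k)).symm inferInstance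
  have hH : ∀ i, i ≠ 0 → IsZero (K.homology i) := by
    intro i hi
    by_cases hi' : i < 0
    · exact ShortComplex.isZero_homology_of_isZero_X₂ _ (hneg i hi')
    · obtain ⟨k, rfl⟩ := Int.eq_ofNat_of_zero_le (not_lt.1 hi')
      obtain _ | k := k
      · exact absurd rfl hi
      · exact (R.complex_exactAt_succ k).isZero_homology.of_iso
          (R.complex.extendHomologyIso embeddingDown (hf (k + 1)))
  let e : K.homology 0 ≅ M := R.complex.extendHomologyIso embeddingDown (hf 0) ≪≫
    isoOfQuasiIsoAt R.π 0 ≪≫ HomologicalComplex.singleObjHomologySelfIso _ _ _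
  let e' : K.homology 0 ≅ K.opcycles 0 :=
    K.isoHomologyι 0 (-1) (by simp) ((hneg (-1) (by lia)).eq_of_tgt _ _)
  have := hasProjectiveDimensionLT_of_iso (e.symm ≪≫ e') (n + 1)
  have := projective_opcycles_of_hasProjectiveDimensionLT hK (fun i hi ↦ hH i hi.ne') n
  exact pdLE_of_complex hK hneg hH e n

lemma pd_lt_top_of_hasProjectiveDimensionLT [EnoughProjectives A] (M : A) (n : ℕ)
    [HasProjectiveDimensionLT M n] : pd M < ⊤ :=
  have := hasProjectiveDimensionLT_of_ge M n (n + 1) (by lia)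
  lt_of_le_of_lt (sInf_le (a := (n : ℕ∞)) ⟨n, rfl, pdLE_of_hasProjectiveDimensionLT M n⟩)
    (ENat.natCast_lt_top n)

end Resolution

section ExtVanishing

universe w

variable [HasExt.{w} A]

lemma subsingleton_ext_of_extIsZero [EnoughProjectives A] {M N : A} {n : ℕ} (hn : n ≠ 0)
    (h : extIsZero M N n) : Subsingleton (Abelian.Ext M N n) := by
  obtain ⟨p, rfl⟩ := Nat.exists_eq_succ_of_ne_zero hn
  let R := ProjectiveResolution.of M
  have hex : (R.complex.linearYonedaObj ℤ N).ExactAt (p + 1) := by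
    rw [HomologicalComplex.exactAt_iff_isZero_homology]
    exact h.of_iso (R.isoExt (p + 1) N).symm
  rw [HomologicalComplex.exactAt_iff' _ p (p + 1) (p + 2) (by simp) (by simp),
    ShortComplex.moduleCat_exact_iff] at hex
  refine subsingleton_of_forall_eq 0 fun α ↦ ?_
  obtain ⟨f, hf, rfl⟩ := R.extMk_surjective α (p + 2) rfl
  rw [R.extMk_eq_zero_iff f (p + 2) rfl hf p rfl]
  exact hex f hf

lemma subsingleton_ext_copies {M N : A} {n : ℕ} [Subsingleton (Abelian.Ext M N n)] (m : ℕ) :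
    Subsingleton (Abelian.Ext (copies M m) N n) :=
  (Abelian.Ext.biproductAddEquiv (biproduct.isBilimit fun _ : Fin m ↦ M) N n).toEquiv.subsingleton

lemma subsingleton_ext_of_iso {X X' N : A} {n : ℕ} (e : X ≅ X')
    [Subsingleton (Abelian.Ext X' N n)] : Subsingleton (Abelian.Ext X N n) := by
  refine subsingleton_of_forall_eq 0 fun α ↦ ?_
  rw [← Abelian.Ext.mk₀_id_comp α, ← e.hom_inv_id, ← Abelian.Ext.mk₀_comp_mk₀_assoc,
    Subsingleton.elim ((Abelian.Ext.mk₀ e.inv).comp α _) 0, Abelian.Ext.comp_zero]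

lemma subsingleton_ext_X₂ {S : ShortComplex A} (hS : S.ShortExact) {N : A} {n : ℕ}
    [Subsingleton (Abelian.Ext S.X₁ N n)] [Subsingleton (Abelian.Ext S.X₃ N n)] :
    Subsingleton (Abelian.Ext S.X₂ N n) := by
  refine subsingleton_of_forall_eq 0 fun α ↦ ?_
  obtain ⟨β, rfl⟩ := Abelian.Ext.contravariant_sequence_exact₂ hS N α (Subsingleton.elim _ _)
  rw [Subsingleton.elim β 0, Abelian.Ext.comp_zero]

lemma subsingleton_ext_X₁ {S : ShortComplex A} (hS : S.ShortExact) {N : A} {n : ℕ}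
    [Subsingleton (Abelian.Ext S.X₂ N n)] [Subsingleton (Abelian.Ext S.X₃ N (n + 1))] :
    Subsingleton (Abelian.Ext S.X₁ N n) := by
  refine subsingleton_of_forall_eq 0 fun α ↦ ?_
  obtain ⟨β, rfl⟩ := Abelian.Ext.contravariant_sequence_exact₁ hS N α (add_comm 1 n)
    (Subsingleton.elim _ _)
  rw [Subsingleton.elim β 0, Abelian.Ext.comp_zero]

/-- If `Ext¹` from the cokernel vanishes, then morphisms extend along a monomorphism. -/
lemma exists_extension {S : ShortComplex A} (hS : S.ShortExact) {N : A}
    [Subsingleton (Abelian.Ext S.X₃ N 1)] (f : S.X₁ ⟶ N) : ∃ g : S.X₂ ⟶ N, S.f ≫ g = f := by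
  obtain ⟨β, hβ⟩ := Abelian.Ext.contravariant_sequence_exact₁ hS N (Abelian.Ext.mk₀ f)
    (add_zero 1) (Subsingleton.elim _ _)
  obtain ⟨g, rfl⟩ := Abelian.Ext.homEquiv₀.symm.surjective β
  refine ⟨g, Abelian.Ext.homEquiv₀.symm.injective ?_⟩
  simpa using hβ

lemma subsingleton_ext_boundaries {K : ChainComplex A ℤ} (hK : ∀ i, Projective (K.X i))
    {N : A} {a t : ℤ} (ha : ∀ i, i < a → IsZero (K.X i))
    (hH : ∀ (i : ℤ) (k : ℕ), 2 ≤ k → k ≤ t + 1 - i → Subsingleton (Abelian.Ext (K.homology i) N k))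
    (i : ℤ) (k : ℕ) (hk : k ≠ 0) (hki : k ≤ t - i) :
    Subsingleton (Abelian.Ext (boundaries K i) N k) := by
  have key : ∀ (m : ℕ) (i : ℤ), i < a + m → ∀ k : ℕ, k ≠ 0 → k ≤ t - i →
      Subsingleton (Abelian.Ext (boundaries K i) N k) := by
    intro m
    induction m with
    | zero =>
      intro i hi k _ _
      have := (isZero_boundaries (ha i (by lia))).hasProjectiveDimensionLT_zero
      exact HasProjectiveDimensionLT.subsingleton _ 0 k (by lia) N
    | succ m ih =>
      intro i hi k hk hki
      obtain ⟨j, rfl⟩ : ∃ j, i = j + 1 := ⟨i - 1, by lia⟩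
      have : Subsingleton (Abelian.Ext (homologyShortComplex K j).X₁ N (k + 1)) :=
        hH _ _ (by lia) (by push_cast; lia)
      have : Subsingleton (Abelian.Ext (homologyShortComplex K j).X₃ N (k + 1)) :=
        ih j (by push_cast at hi; lia) _ (by lia) (by push_cast; lia)
      have : Subsingleton (Abelian.Ext (boundariesShortComplex K (j + 1)).X₃ N (k + 1)) :=
        subsingleton_ext_X₂ (homologyShortComplex_shortExact K j)
      have : Subsingleton (Abelian.Ext (boundariesShortComplex K (j + 1)).X₂ N k) :=
        HasProjectiveDimensionLT.subsingleton (K.X (j + 1)) 1 k (by lia) N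
      exact subsingleton_ext_X₁ (boundariesShortComplex_shortExact K (j + 1))
  exact key (i + 1 - a).toNat i (by lia) k hk hki

end ExtVanishing

end QPD

open QPD in
/-- If `M` has a finite quasi-projective resolution `P•` and
`Ext^n(M, M) = 0` for `2 ≤ n ≤ hsup P• - hinf P• + 1`, then `pd M < ∞`. -/
theorem pd_lt_top_of_ext_vanishing_range {A : Type*} [Category A] [Abelian A]
    [EnoughProjectives A]
    (M : A) (P : ChainComplex A ℤ) (hP : IsFiniteQuasiProjRes M P)
    (t s : ℤ) (ht : IsHSup P t) (hs : IsHInf P s)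
    (hext : ∀ n : ℕ, 2 ≤ n → (n : ℤ) ≤ t - s + 1 → extIsZero M M n) :
    pd M < ⊤ := by
  let := HasExt.standard A
  obtain ⟨a, ha⟩ := hP.bddBelow
  obtain ⟨b, hb⟩ := hP.bddAbove
  obtain ⟨mult, -, hmult⟩ := hP.homology_iso
  have hH : ∀ (i : ℤ) (k : ℕ), 2 ≤ k → k ≤ t + 1 - i →
      Subsingleton (Abelian.Ext (P.homology i) M k) := by
    intro i k hk hki
    by_cases his : i < s
    · have := (hs.2 i his).hasProjectiveDimensionLT_zero
      exact HasProjectiveDimensionLT.subsingleton _ 0 k (by lia) M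
    · have := subsingleton_ext_of_extIsZero (by lia) (hext k hk (by lia))
      have := subsingleton_ext_copies (M := M) (N := M) (n := k) (mult i)
      exact subsingleton_ext_of_iso (hmult i).some
  obtain ⟨r, rfl⟩ : ∃ r, t = r + 1 := ⟨t - 1, by lia⟩
  have : Subsingleton (Abelian.Ext (homologyShortComplex P r).X₃ M 1) :=
    subsingleton_ext_boundaries hP.projective ha hH r 1 (by lia) (by lia)
  obtain ⟨e⟩ := hmult (r + 1)
  have hpos : 0 < mult (r + 1) := by
    by_contra h
    refine ht.1 (IsZero.of_iso ?_ e)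
    rw [show mult (r + 1) = 0 by lia, IsZero.iff_id_eq_zero]
    exact biproduct.hom_ext _ _ fun j ↦ j.elim0
  let j : Fin (mult (r + 1)) := ⟨0, hpos⟩
  let π : copies M (mult (r + 1)) ⟶ M := biproduct.π (fun _ ↦ M) j
  let ι : M ⟶ copies M (mult (r + 1)) := biproduct.ι (fun _ ↦ M) j
  have hιπ : ι ≫ π = 𝟙 M := biproduct.ι_π_self _ j
  obtain ⟨g, hg⟩ := exists_extension (homologyShortComplex_shortExact P r) (e.hom ≫ π)
  let ρ : Retract M (P.opcycles (r + 1)) :=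
    { i := ι ≫ e.inv ≫ P.homologyι (r + 1)
      r := g
      retract := by simp [hg, hιπ] }
  obtain ⟨n, hn⟩ := exists_hasProjectiveDimensionLT_opcycles hP.projective hb ht.2
  have := ρ.hasProjectiveDimensionLT n
  exact pd_lt_top_of_hasProjectiveDimensionLT M n
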